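/- arXiv:1709.08909 — 8 statements merged into one kernel-verified Lean document; each statement's English description precedes it below -/
import Mathlib

section
/- Let L ≥ 1, let φ : Fin L → ℝ be strictly increasing, let P : ℝ → ℝ be strictly decreasing, and let θ : Fin L → ℝ be arbitrary prices. Suppose α > α' are two positive user weights, l is the unique maximizer over Fin L of the surplus function l' ↦ α·P(φ(l')) − θ(l'), and l* is the unique maximizer over Fin L of l' ↦ α'·P(φ(l')) − θ(l'). Then l ≤ l*, i.e., the user with the larger weight chooses an SLA with a waiting time no larger than that chosen by the user with the smaller weight. -/
/-- Monotone choice: the user with the larger weight chooses an SLA with a waiting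
time (index) no larger than that chosen by the user with the smaller weight. -/
theorem monotone_choice (L : ℕ) (hL : 1 ≤ L) (φ : Fin L → ℝ) (hφ : StrictMono φ)
    (P : ℝ → ℝ) (hP : StrictAnti P) (θ : Fin L → ℝ)
    (α α' : ℝ) (hα'pos : 0 < α') (hαα' : α' < α)
    (l lstar : Fin L)
    (hl : ∀ l' : Fin L, l' ≠ l → α * P (φ l) - θ l > α * P (φ l') - θ l')
    (hlstar : ∀ l' : Fin L, l' ≠ lstar → α' * P (φ lstar) - θ lstar > α' * P (φ l') - θ l') :
    l ≤ lstar := by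
  by_contra! h
  have hPφ : P (φ l) < P (φ lstar) := hP (hφ h)
  have h₁ := hl lstar h.ne
  have h₂ := hlstar l h.ne'
  linarith [mul_pos (sub_pos.2 hαα') (sub_pos.2 hPφ)]
end

section
/- Let K ≥ L ≥ 1, let α : Fin K → ℝ be strictly decreasing with all values positive, let φ : Fin L → ℝ be strictly increasing, let P : ℝ → ℝ be strictly decreasing, and let θ : Fin L → ℝ be prices. Suppose σ : Fin K → Fin L is such that for every user i, σ(i) is the unique maximizer over Fin L of l ↦ α(i)·P(φ(l)) − θ(l), and suppose σ is surjective (every SLA is chosen by at least one user). Then there exist integers 0 = i₀ < i₁ < i₂ < … < i_L = K such that for every l ∈ {1, …, L} and every user index i ∈ {1, …, K}, σ(i) = l if and only if i_{l−1} < i ≤ i_l; that is, each SLA is chosen exactly by a consecutive block of users, with higher-weight users choosing lower-latency SLAs. -/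
/-- An index lies below the cardinality of an initial segment of `Fin K` iff it belongs to it. -/
theorem Fin.val_lt_card_filter_iff_of_antitone {K : ℕ} {p : Fin K → Prop} [DecidablePred p]
    (hp : Antitone p) (i : Fin K) : (i : ℕ) < (Finset.univ.filter p).card ↔ p i := by
  constructor
  · intro h
    by_contra hi
    have hsub : Finset.univ.filter p ⊆ Finset.Iio i := by
      intro j hj
      rw [Finset.mem_filter] at hj
      rw [Finset.mem_Iio]
      exact lt_of_not_ge fun hij => hi (hp hij hj.2)
    have hcard := Finset.card_le_card hsub
    rw [Fin.card_Iio] at hcard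
    omega
  · intro hi
    have hsub : Finset.Iic i ⊆ Finset.univ.filter p := by
      intro j hj
      exact Finset.mem_filter.2 ⟨Finset.mem_univ j, hp (Finset.mem_Iic.1 hj) hi⟩
    have hcard := Finset.card_le_card hsub
    rw [Fin.card_Iic] at hcard
    omega

/-- The fibres of a monotone surjection `Fin K → Fin L` are consecutive blocks. -/
theorem Fin.exists_thresholds_of_monotone_of_surjective {K L : ℕ} {σ : Fin K → Fin L}
    (hσ : Monotone σ) (hsurj : Function.Surjective σ) :
    ∃ b : Fin (L + 1) → ℕ, b 0 = 0 ∧ b (Fin.last L) = K ∧ StrictMono b ∧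
      ∀ (l : Fin L) (i : Fin K),
        σ i = l ↔ (b l.castSucc ≤ (i : ℕ) ∧ (i : ℕ) < b l.succ) := by
  let b : Fin (L + 1) → ℕ := fun m => (Finset.univ.filter fun i => (σ i : ℕ) < m).card
  have hb (m : Fin (L + 1)) (i : Fin K) : (i : ℕ) < b m ↔ (σ i : ℕ) < m :=
    Fin.val_lt_card_filter_iff_of_antitone (p := fun i => (σ i : ℕ) < m)
      (fun _ _ hij h => lt_of_le_of_lt (hσ hij) h) i
  have hblock (l : Fin L) (i : Fin K) :
      σ i = l ↔ (b l.castSucc ≤ (i : ℕ) ∧ (i : ℕ) < b l.succ) := by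
    rw [← not_lt, hb, hb, Fin.ext_iff, Fin.val_castSucc, Fin.val_succ]
    omega
  refine ⟨b, by simp [b], by simp [b], Fin.strictMono_iff_lt_succ.2 fun l => ?_, hblock⟩
  obtain ⟨i, hi⟩ := hsurj l
  exact lt_of_le_of_lt ((hblock l i).1 hi).1 ((hblock l i).1 hi).2


/-- Threshold structure of the users' SLA choices (Lemma 4): if every user uniquely
maximizes its surplus at `σ i` and every SLA is chosen by some user, then there exist
thresholds `0 = i₀ < i₁ < … < i_L = K` such that SLA `l` is chosen exactly by the
consecutive block of users with (0-based) indices in `[i_{l-1}, i_l)`. -/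
theorem threshold_structure (K L : ℕ) (hL : 1 ≤ L) (hKL : L ≤ K)
    (α : Fin K → ℝ) (hα : StrictAnti α) (hαpos : ∀ i, 0 < α i)
    (φ : Fin L → ℝ) (hφ : StrictMono φ)
    (P : ℝ → ℝ) (hP : StrictAnti P)
    (θ : Fin L → ℝ) (σ : Fin K → Fin L)
    (hσ : ∀ (i : Fin K) (l : Fin L), l ≠ σ i →
      α i * P (φ (σ i)) - θ (σ i) > α i * P (φ l) - θ l)
    (hsurj : Function.Surjective σ) :
    ∃ b : Fin (L + 1) → ℕ, b 0 = 0 ∧ b (Fin.last L) = K ∧ StrictMono b ∧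
      ∀ (l : Fin L) (i : Fin K),
        σ i = l ↔ (b l.castSucc ≤ (i : ℕ) ∧ (i : ℕ) < b l.succ) := by
  refine Fin.exists_thresholds_of_monotone_of_surjective (fun i j hij => ?_) hsurj
  by_contra! hlt
  have hαij := hα.antitone hij
  have hPij := hP (hφ hlt)
  have hi := hσ i (σ j) hlt.ne
  have hj := hσ j (σ i) hlt.ne'
  nlinarith [mul_nonneg (sub_nonneg.2 hαij) (sub_pos.2 hPij).le]
end

section
/- Let v : Fin n → ℝ be unit revenues with v_1 ≥ v_2 ≥ … ≥ v_n ≥ 0, let c : Fin n → ℕ be capacities, and let m ∈ ℕ be a server budget. Define the greedy allocation g : Fin n → ℕ recursively by g_i = min(c_i, m − Σ_{j<i} g_j). Then g is feasible (g_i ≤ c_i for all i and Σ_i g_i ≤ m), and for every feasible allocation x : Fin n → ℕ (x_i ≤ c_i for all i and Σ_i x_i ≤ m) it holds that Σ_i x_i · v_i ≤ Σ_i g_i · v_i. -/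
section Greedy

variable {ι : Type*} [LinearOrder ι] [LocallyFiniteOrderBot ι]
  {c g : ι → ℕ} {m : ℕ}

/-- Up to any index receiving a server, the greedy allocation stays within budget. -/
lemma greedy_sum_Iic_le (hg : ∀ i, g i = min (c i) (m - ∑ j ∈ Finset.Iio i, g j))
    {i : ι} (hi : 0 < g i) : ∑ j ∈ Finset.Iic i, g j ≤ m := by
  have h := hg i
  rw [← Finset.Iio_insert i, Finset.sum_insert (by simp)]
  omega

/-- Once an index is not filled to capacity, the budget is exhausted. -/
lemma greedy_le_sum_Iic (hg : ∀ i, g i = min (c i) (m - ∑ j ∈ Finset.Iio i, g j))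
    {k : ι} (hk : g k < c k) : m ≤ ∑ j ∈ Finset.Iic k, g j := by
  have h := hg k
  rw [← Finset.Iio_insert k, Finset.sum_insert (by simp)]
  omega

/-- After an index that is not filled to capacity, nothing is allocated. -/
lemma greedy_eq_zero_of_lt (hg : ∀ i, g i = min (c i) (m - ∑ j ∈ Finset.Iio i, g j))
    {k i : ι} (hk : g k < c k) (hki : k < i) : g i = 0 := by
  have hle : ∑ j ∈ Finset.Iic k, g j ≤ ∑ j ∈ Finset.Iio i, g j :=
    Finset.sum_le_sum_of_subset fun j hj =>
      Finset.mem_Iio.mpr ((Finset.mem_Iic.mp hj).trans_lt hki)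
  have h := hg i
  have hm := greedy_le_sum_Iic hg hk
  omega

variable [Fintype ι]

/-- The greedy allocation respects the total budget. -/
lemma greedy_sum_le (hg : ∀ i, g i = min (c i) (m - ∑ j ∈ Finset.Iio i, g j)) :
    ∑ i, g i ≤ m := by
  by_cases hpos : ∃ i, 0 < g i
  · obtain ⟨i, hi, hmax⟩ := (Set.toFinite {i | 0 < g i}).exists_maximal hpos
    refine le_trans (le_of_eq ?_) (greedy_sum_Iic_le hg hi)
    refine (Finset.sum_subset (Finset.subset_univ _) fun j _ hj => ?_).symm
    rw [Finset.mem_Iic, not_le] at hj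
    by_contra h
    exact hj.not_ge (hmax (Nat.pos_of_ne_zero h) hj.le)
  · push Not at hpos
    rw [Finset.sum_eq_zero fun i _ => Nat.le_zero.mp (hpos i)]
    exact Nat.zero_le m

/-- The greedy allocation earns at least as much as any other feasible allocation. -/
lemma sum_mul_le_greedy {v : ι → ℝ} (hv : Antitone v) (hv0 : ∀ i, 0 ≤ v i)
    (hg : ∀ i, g i = min (c i) (m - ∑ j ∈ Finset.Iio i, g j))
    {x : ι → ℕ} (hxc : ∀ i, x i ≤ c i) (hxm : ∑ i, x i ≤ m) :
    ∑ i, (x i : ℝ) * v i ≤ ∑ i, (g i : ℝ) * v i := by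
  by_cases hlt : ∃ k, g k < c k
  · obtain ⟨k, hk, hmin⟩ := (Set.toFinite {k | g k < c k}).exists_minimal hlt
    have hterm : ∀ i, ((x i : ℝ) - g i) * v i ≤ ((x i : ℝ) - g i) * v k := by
      intro i
      rcases lt_trichotomy i k with hik | rfl | hki
      · have hcg : c i ≤ g i := by
          by_contra! h
          exact hik.not_ge (hmin h hik.le)
        have hxg : (x i : ℝ) ≤ g i := by exact_mod_cast (hxc i).trans hcg
        exact mul_le_mul_of_nonpos_left (hv hik.le) (sub_nonpos.mpr hxg)
      · exact le_rfl
      · rw [greedy_eq_zero_of_lt hg hk hki, Nat.cast_zero, sub_zero]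
        exact mul_le_mul_of_nonneg_left (hv hki.le) (Nat.cast_nonneg _)
    have hsum : ∑ i, ((x i : ℝ) - g i) ≤ 0 := by
      rw [Finset.sum_sub_distrib, sub_nonpos]
      exact_mod_cast hxm.trans ((greedy_le_sum_Iic hg hk).trans
        (Finset.sum_le_sum_of_subset (Finset.subset_univ _)))
    rw [← sub_nonpos, ← Finset.sum_sub_distrib]
    calc ∑ i, ((x i : ℝ) * v i - g i * v i)
        = ∑ i, ((x i : ℝ) - g i) * v i := by simp only [sub_mul]
      _ ≤ ∑ i, ((x i : ℝ) - g i) * v k := Finset.sum_le_sum fun i _ => hterm i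
      _ = (∑ i, ((x i : ℝ) - g i)) * v k := (Finset.sum_mul ..).symm
      _ ≤ 0 := mul_nonpos_of_nonpos_of_nonneg hsum (hv0 k)
  · push Not at hlt
    exact Finset.sum_le_sum fun i _ =>
      mul_le_mul_of_nonneg_right (by exact_mod_cast (hxc i).trans (hlt i)) (hv0 i)

end Greedy

/-- Optimality of the greedy allocation (core of Theorem 2): with unit revenues in
non-increasing order, the greedy allocation `g i = min (c i) (m − ∑_{j<i} g j)` is
feasible and maximizes the total revenue among all feasible allocations. -/
theorem greedy_allocation_optimal (n : ℕ) (v : Fin n → ℝ) (hv : Antitone v)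
    (hv0 : ∀ i, 0 ≤ v i) (c : Fin n → ℕ) (m : ℕ) (g : Fin n → ℕ)
    (hg : ∀ i, g i = min (c i) (m - ∑ j ∈ Finset.Iio i, g j)) :
    (∀ i, g i ≤ c i) ∧ (∑ i, g i) ≤ m ∧
      ∀ x : Fin n → ℕ, (∀ i, x i ≤ c i) → (∑ i, x i) ≤ m →
        (∑ i, (x i : ℝ) * v i) ≤ ∑ i, (g i : ℝ) * v i := by
  exact ⟨fun i => (hg i).trans_le (min_le_left _ _), greedy_sum_le hg,
    fun _ hxc hxm => sum_mul_le_greedy hv hv0 hg hxc hxm⟩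
end

section
/- Let L ≥ 1, let θ : Fin L → ℝ be positive prices, λ : Fin L → ℝ be positive maximum per-server arrival rates, Λ̄ : Fin L → ℝ be nonnegative offered arrival rates, and m ∈ ℕ. Consider the feasible set F = { Λ : Fin L → ℝ | for all l, 0 ≤ Λ_l ≤ Λ̄_l, and Σ_l ⌈Λ_l/λ_l⌉ ≤ m }. Then the supremum of Σ_l θ_l·Λ_l over F is attained, and moreover it is attained at some Λ* ∈ F such that for every l, either Λ*_l = Λ̄_l or Λ*_l is a nonnegative integer multiple of λ_l. -/
/-- Lemmas 2–3: the revenue supremum over the admission-control feasible set is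
attained, and it is attained at a point where each accepted rate is either the full
offered rate or a nonnegative integer multiple of the per-server maximum rate. -/
theorem admission_control_attained (L : ℕ) (hL : 1 ≤ L)
    (θ lam Λbar : Fin L → ℝ)
    (hθ : ∀ l, 0 < θ l) (hlam : ∀ l, 0 < lam l) (hΛbar : ∀ l, 0 ≤ Λbar l) (m : ℕ) :
    ∃ Λstar : Fin L → ℝ,
      ((∀ l, 0 ≤ Λstar l ∧ Λstar l ≤ Λbar l) ∧ (∑ l, ⌈Λstar l / lam l⌉) ≤ (m : ℤ)) ∧
      (∀ Λ : Fin L → ℝ, (∀ l, 0 ≤ Λ l ∧ Λ l ≤ Λbar l) →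
        (∑ l, ⌈Λ l / lam l⌉) ≤ (m : ℤ) →
        (∑ l, θ l * Λ l) ≤ ∑ l, θ l * Λstar l) ∧
      (∀ l, Λstar l = Λbar l ∨ ∃ k : ℕ, Λstar l = (k : ℝ) * lam l) := by
  let revenue : (Fin L → ℕ) → ℝ := fun n => ∑ l, θ l * min (Λbar l) (n l * lam l)
  have hfin : {n : Fin L → ℕ | ∑ l, n l ≤ m}.Finite :=
    (Set.finite_Iic fun _ => m).subset fun n hn l =>
      (Finset.single_le_sum (fun i _ => Nat.zero_le (n i)) (Finset.mem_univ l)).trans hn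
  obtain ⟨n, hn, hmax⟩ := Set.exists_max_image _ revenue hfin ⟨0, by simp⟩
  refine ⟨fun l => min (Λbar l) (n l * lam l), ⟨fun l => ⟨?_, min_le_left _ _⟩, ?_⟩, ?_, fun l => ?_⟩
  · exact le_min (hΛbar l) (mul_nonneg (n l).cast_nonneg (hlam l).le)
  · calc ∑ l, ⌈min (Λbar l) (n l * lam l) / lam l⌉ ≤ ∑ l, (n l : ℤ) :=
          Finset.sum_le_sum fun l _ => Int.ceil_le.2 <| by
            rw [div_le_iff₀ (hlam l)]
            exact_mod_cast min_le_right _ _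
      _ ≤ (m : ℤ) := by exact_mod_cast hn
  · intro Λ hΛ hsum
    have hservers : ∑ l, ⌈Λ l / lam l⌉₊ ≤ m := by
      zify
      simpa only [Int.natCast_ceil_eq_ceil (div_nonneg (hΛ _).1 (hlam _).le)] using hsum
    calc ∑ l, θ l * Λ l ≤ revenue fun l => ⌈Λ l / lam l⌉₊ :=
          Finset.sum_le_sum fun l _ => mul_le_mul_of_nonneg_left
            (le_min (hΛ l).2 ((div_le_iff₀ (hlam l)).1 (Nat.le_ceil _))) (hθ l).le
      _ ≤ revenue n := hmax _ hservers
  · rcases min_choice (Λbar l) (n l * lam l) with h | h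
    · exact Or.inl h
    · exact Or.inr ⟨n l, h⟩
end

section
/- Let L ≥ 1, let θ : Fin L → ℝ be positive prices, λ : Fin L → ℝ be positive maximum per-server arrival rates, Λ̄ : Fin L → ℝ be nonnegative offered arrival rates, and m ∈ ℕ. For each l let r_l = Λ̄_l − λ_l·⌊Λ̄_l/λ_l⌋. Then the supremum of Σ_l θ_l·Λ_l over the feasible set F = { Λ : Fin L → ℝ | for all l, 0 ≤ Λ_l ≤ Λ̄_l, and Σ_l ⌈Λ_l/λ_l⌉ ≤ m } equals the maximum, over all integer vectors (a, b) with a_l ∈ ℕ, a_l ≤ ⌊Λ̄_l/λ_l⌋, b_l ∈ {0,1}, b_l = 0 whenever r_l = 0, and Σ_l (a_l + b_l) ≤ m, of Σ_l θ_l·(λ_l·a_l + r_l·b_l). -/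
/-- The residual `y - c * ⌊y / c⌋` lies in `[0, c)`. -/
theorem residual_nonneg_and_lt {c : ℝ} (hc : 0 < c) (y : ℝ) :
    0 ≤ y - c * (⌊y / c⌋ : ℝ) ∧ y - c * (⌊y / c⌋ : ℝ) < c := by
  have h1 := Int.floor_le (y / c)
  have h2 := Int.lt_floor_add_one (y / c)
  rw [le_div_iff₀ hc] at h1
  rw [div_lt_iff₀ hc] at h2
  constructor <;> linarith

/-- A rate `x ≤ y` is dominated by full servers plus at most one residual server,
using the same number of servers. -/
theorem exists_full_add_residual_ge {c x y : ℝ} (hc : 0 < c) (hx : 0 ≤ x) (hxy : x ≤ y) :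
    ∃ a b : ℕ, (a : ℤ) ≤ ⌊y / c⌋ ∧ b ≤ 1 ∧
      (y - c * (⌊y / c⌋ : ℝ) = 0 → b = 0) ∧ ((a : ℤ) + b = ⌈x / c⌉) ∧
      x ≤ c * (a : ℝ) + (y - c * (⌊y / c⌋ : ℝ)) * (b : ℝ) := by
  have hn : 0 ≤ ⌈x / c⌉ := Int.ceil_nonneg (div_nonneg hx hc.le)
  have hf : 0 ≤ ⌊y / c⌋ := Int.floor_nonneg.mpr (div_nonneg (hx.trans hxy) hc.le)
  have hmono : ⌈x / c⌉ ≤ ⌈y / c⌉ := Int.ceil_mono (by gcongr)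
  have hle := Int.ceil_le_floor_add_one (y / c)
  by_cases h : ⌈x / c⌉ ≤ ⌊y / c⌋
  · obtain ⟨n, hn⟩ := Int.eq_ofNat_of_zero_le hn
    refine ⟨n, 0, hn ▸ h, zero_le_one, fun _ => rfl, by simp [hn], ?_⟩
    have h1 := Int.le_ceil (x / c)
    rw [hn, div_le_iff₀ hc] at h1
    push_cast at h1 ⊢
    linarith
  · obtain ⟨k, hk⟩ := Int.eq_ofNat_of_zero_le hf
    refine ⟨k, 1, hk.ge, le_rfl, fun h0 => ?_, by push_cast; omega, ?_⟩
    · have hdiv : y / c = (⌊y / c⌋ : ℝ) := by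
        rw [div_eq_iff hc.ne']
        linarith
      have hceil : ⌈y / c⌉ ≤ ⌊y / c⌋ := Int.ceil_le.mpr hdiv.le
      omega
    · rw [hk]
      push_cast
      linarith

/-- The rate carried by `a` full servers and `b ≤ 1` residual servers is admissible and
needs at most `a + b` servers. -/
theorem full_add_residual_feasible {c y : ℝ} (hc : 0 < c) {a b : ℕ}
    (ha : (a : ℤ) ≤ ⌊y / c⌋) (hb : b ≤ 1) :
    0 ≤ c * (a : ℝ) + (y - c * (⌊y / c⌋ : ℝ)) * (b : ℝ) ∧
      c * (a : ℝ) + (y - c * (⌊y / c⌋ : ℝ)) * (b : ℝ) ≤ y ∧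
      ⌈(c * (a : ℝ) + (y - c * (⌊y / c⌋ : ℝ)) * (b : ℝ)) / c⌉ ≤ (a : ℤ) + b := by
  obtain ⟨hr0, hrc⟩ := residual_nonneg_and_lt hc y
  have ha' : (a : ℝ) ≤ (⌊y / c⌋ : ℝ) := by exact_mod_cast ha
  have hb' : (b : ℝ) ≤ 1 := by exact_mod_cast hb
  have h1 := mul_le_mul_of_nonneg_left ha' hc.le
  have h2 := mul_le_mul_of_nonneg_left hb' hr0
  have h3 := mul_le_mul_of_nonneg_right hrc.le (Nat.cast_nonneg (α := ℝ) b)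
  refine ⟨by positivity, by linarith, ?_⟩
  rw [Int.ceil_le, div_le_iff₀ hc]
  push_cast
  linarith


/-- Theorem 1: the supremum of the continuous admission-control and capacity-planning
problem equals the maximum of the integer problem over the `2L` virtual queues, where
for each SLA `l`, `a l` servers are fully loaded at rate `lam l` and `b l ∈ {0,1}`
servers carry the residual rate `r l = Λbar l − lam l·⌊Λbar l / lam l⌋`. -/
theorem continuous_eq_integer_capacity_planning (L : ℕ) (hL : 1 ≤ L)
    (θ lam Λbar : Fin L → ℝ)
    (hθ : ∀ l, 0 < θ l) (hlam : ∀ l, 0 < lam l) (hΛbar : ∀ l, 0 ≤ Λbar l) (m : ℕ) :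
    ∃ V : ℝ,
      IsLUB {x : ℝ | ∃ Λ : Fin L → ℝ,
        (∀ l, 0 ≤ Λ l ∧ Λ l ≤ Λbar l) ∧ (∑ l, ⌈Λ l / lam l⌉) ≤ (m : ℤ) ∧
        x = ∑ l, θ l * Λ l} V ∧
      IsGreatest {x : ℝ | ∃ a b : Fin L → ℕ,
        (∀ l, (a l : ℤ) ≤ ⌊Λbar l / lam l⌋) ∧
        (∀ l, b l ≤ 1) ∧
        (∀ l, Λbar l - lam l * (⌊Λbar l / lam l⌋ : ℝ) = 0 → b l = 0) ∧
        (∑ l, (a l + b l)) ≤ m ∧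
        x = ∑ l, θ l * (lam l * (a l : ℝ) +
          (Λbar l - lam l * (⌊Λbar l / lam l⌋ : ℝ)) * (b l : ℝ))} V := by
  set S := {x : ℝ | ∃ a b : Fin L → ℕ,
        (∀ l, (a l : ℤ) ≤ ⌊Λbar l / lam l⌋) ∧
        (∀ l, b l ≤ 1) ∧
        (∀ l, Λbar l - lam l * (⌊Λbar l / lam l⌋ : ℝ) = 0 → b l = 0) ∧
        (∑ l, (a l + b l)) ≤ m ∧
        x = ∑ l, θ l * (lam l * (a l : ℝ) +
          (Λbar l - lam l * (⌊Λbar l / lam l⌋ : ℝ)) * (b l : ℝ))}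
  have hfin : S.Finite := by
    refine (((Set.finite_Iic (fun l => ⌊Λbar l / lam l⌋.toNat)).prod
      (Set.finite_Iic (fun _ : Fin L => 1))).image
      (fun p : (Fin L → ℕ) × (Fin L → ℕ) => ∑ l, θ l * (lam l * (p.1 l : ℝ) +
          (Λbar l - lam l * (⌊Λbar l / lam l⌋ : ℝ)) * (p.2 l : ℝ)))).subset ?_
    rintro x ⟨a, b, ha, hb, -, -, rfl⟩
    refine ⟨(a, b), ⟨fun l => ?_, hb⟩, rfl⟩
    have := ha l
    simp only
    omega
  have hne : S.Nonempty :=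
    ⟨_, 0, 0, fun l => by simpa using Int.floor_nonneg.mpr (div_nonneg (hΛbar l) (hlam l).le),
      by simp, by simp, by simp, rfl⟩
  have hV : IsGreatest S (sSup S) :=
    ⟨hne.csSup_mem hfin, fun x hx => le_csSup hfin.bddAbove hx⟩
  refine ⟨sSup S, IsGreatest.isLUB ⟨?_, ?_⟩, hV⟩
  · obtain ⟨a, b, ha, hb, -, hm, hx⟩ := hV.1
    have hfeas := fun l => full_add_residual_feasible (hlam l) (ha l) (hb l)
    refine ⟨_, fun l => ⟨(hfeas l).1, (hfeas l).2.1⟩, ?_, hx⟩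
    exact (Finset.sum_le_sum fun l _ => (hfeas l).2.2).trans (by exact_mod_cast hm)
  · rintro x ⟨Λ, hΛ, hm, rfl⟩
    choose a b ha hb hr hab hle using
      fun l => exists_full_add_residual_ge (hlam l) (hΛ l).1 (hΛ l).2
    refine le_trans (Finset.sum_le_sum fun l _ => mul_le_mul_of_nonneg_left (hle l) (hθ l).le)
      (hV.2 ⟨a, b, ha, hb, hr, ?_, rfl⟩)
    simp only [← hab] at hm
    exact_mod_cast hm
end

section
/- Let L ≥ 1, let p : Fin L → ℝ satisfy p_1 > p_2 > … > p_L > 0 (the utility values P(φ_l) of the strictly increasing waiting times), and let a : Fin L → ℝ and b : Fin L → ℝ be positive weights with b_l < a_l for all l (a_l = α_{i_l} is the weight of the last user choosing SLA l and b_l = α_{i_l + 1} is the weight of the next user, and a_{l+1} ≤ b_l for l < L). Then there exist prices θ : Fin L → ℝ such that 0 < θ_L < a_L·p_L and, for every l < L, b_l·(p_l − p_{l+1}) + θ_{l+1} < θ_l < a_l·(p_l − p_{l+1}) + θ_{l+1}; moreover, every such price vector satisfies θ_1 > θ_2 > … > θ_L > 0. -/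
/-- A real sequence that strictly decreases at each of its first `L - 1` steps is strictly
decreasing on the indices below `L`. -/
lemma lt_of_succ_lt_below {L : ℕ} {θ : ℕ → ℝ} (h : ∀ l, l + 1 < L → θ (l + 1) < θ l)
    {k l : ℕ} (hkl : k < l) (hl : l < L) : θ l < θ k := by
  induction l, hkl using Nat.le_induction with
  | base => exact h k hl
  | succ m _ ih => exact (h m hl).trans (ih (by omega))

/-- Well-posedness of Definition 5 (0-based indexing: index `l` ranges over `l < L`,
`p l` is the utility value `P(φ_{l+1})`, `a l` the weight of the last user choosing
SLA `l+1`, `b l` the weight of the next user): prices satisfying the interval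
conditions exist, and every such price vector is strictly decreasing and positive. -/
theorem definition5_well_posed (L : ℕ) (hL : 1 ≤ L) (p a b : ℕ → ℝ)
    (hp : ∀ k l, k < l → l < L → p l < p k) (hppos : ∀ l, l < L → 0 < p l)
    (hapos : ∀ l, l < L → 0 < a l) (hbpos : ∀ l, l < L → 0 < b l)
    (hba : ∀ l, l < L → b l < a l)
    (hab : ∀ l, l + 1 < L → a (l + 1) ≤ b l) :
    (∃ θ : ℕ → ℝ,
      (0 < θ (L - 1) ∧ θ (L - 1) < a (L - 1) * p (L - 1)) ∧
      (∀ l, l + 1 < L →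
        b l * (p l - p (l + 1)) + θ (l + 1) < θ l ∧
        θ l < a l * (p l - p (l + 1)) + θ (l + 1))) ∧
    (∀ θ : ℕ → ℝ,
      ((0 < θ (L - 1) ∧ θ (L - 1) < a (L - 1) * p (L - 1)) ∧
       (∀ l, l + 1 < L →
         b l * (p l - p (l + 1)) + θ (l + 1) < θ l ∧
         θ l < a l * (p l - p (l + 1)) + θ (l + 1))) →
      (∀ k l, k < l → l < L → θ l < θ k) ∧ (∀ l, l < L → 0 < θ l)) := by
  have hgap : ∀ l, l + 1 < L → 0 < p l - p (l + 1) := fun l hl =>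
    sub_pos.mpr (hp l (l + 1) l.lt_succ_self hl)
  have hlast : L - 1 < L := by omega
  refine ⟨⟨fun l => a (L - 1) * p (L - 1) / 2 +
      ∑ i ∈ Finset.Ico l (L - 1), (a i + b i) / 2 * (p i - p (i + 1)), ?_, ?_⟩, ?_⟩
  · have := mul_pos (hapos _ hlast) (hppos _ hlast)
    simp only [Finset.Ico_self, Finset.sum_empty]
    constructor <;> linarith
  · intro l hl
    have := mul_pos (sub_pos.mpr (hba l (by omega))) (hgap l hl)
    simp only [Finset.sum_eq_sum_Ico_succ_bot (show l < L - 1 by omega)]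
    constructor <;> linarith
  · rintro θ ⟨⟨hpos, -⟩, hθ⟩
    have hdec : ∀ k l, k < l → l < L → θ l < θ k := fun k l =>
      lt_of_succ_lt_below fun m hm => by
        linarith [(hθ m hm).1, mul_pos (hbpos m (by omega)) (hgap m hm)]
    refine ⟨hdec, fun l hl => ?_⟩
    rcases (show l ≤ L - 1 by omega).eq_or_lt with rfl | hlt
    · exact hpos
    · exact hpos.trans (hdec l (L - 1) hlt hlast)
end

section
/- Let K ≥ L ≥ 1, let α : Fin K → ℝ satisfy α_1 > α_2 > … > α_K > 0, let p : Fin L → ℝ satisfy p_1 > p_2 > … > p_L > 0, and let 1 ≤ i_1 < i_2 < … < i_L ≤ K be thresholds with i_l < K for l < L. Suppose the prices θ : Fin L → ℝ satisfy: 0 < θ_L < α_{i_L}·p_L, and for every l < L, α_{i_l+1}·(p_l − p_{l+1}) + θ_{l+1} < θ_l < α_{i_l}·(p_l − p_{l+1}) + θ_{l+1}. Then for every l ∈ {1, …, L} and every user i with i_{l−1} < i ≤ i_l (where i_0 = 0): (a) SLA l is the unique maximizer over l' ∈ {1, …, L} of the surplus α_i·p_{l'} − θ_{l'}, and (b) the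 resulting surplus is strictly positive: α_i·p_l − θ_l > 0. -/
/-- Incentive compatibility of the prices of Definition 5 (Theorem 3), 0-based
indexing: users `0, …, K−1` have weights `α 0 > α 1 > … > α (K−1) > 0`; SLAs
`0, …, L−1` have utility values `p 0 > … > p (L−1) > 0`; `t l` is the 1-based index
of the last user choosing SLA `l` (so that user with 0-based index `j` chooses SLA `l`
iff `t l' ≤ j` for all `l' < l` and `j < t l`).  Under the interval conditions on the
prices, each such user uniquely maximizes its surplus at SLA `l`, with positive surplus. -/
theorem definition5_incentive_compatible (K L : ℕ) (hL : 1 ≤ L) (hKL : L ≤ K)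
    (α : ℕ → ℝ) (hα : ∀ i j, i < j → j < K → α j < α i) (hαpos : ∀ i, i < K → 0 < α i)
    (p : ℕ → ℝ) (hp : ∀ k l, k < l → l < L → p l < p k) (hppos : ∀ l, l < L → 0 < p l)
    (t : ℕ → ℕ) (ht : ∀ k l, k < l → l < L → t k < t l)
    (ht1 : 1 ≤ t 0) (htK : t (L - 1) ≤ K) (htK' : ∀ l, l + 1 < L → t l < K)
    (θ : ℕ → ℝ)
    (hθL : 0 < θ (L - 1) ∧ θ (L - 1) < α (t (L - 1) - 1) * p (L - 1))
    (hθ : ∀ l, l + 1 < L →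
      α (t l) * (p l - p (l + 1)) + θ (l + 1) < θ l ∧
      θ l < α (t l - 1) * (p l - p (l + 1)) + θ (l + 1)) :
    ∀ l, l < L → ∀ j, j < K → (∀ l', l' < l → t l' ≤ j) → j < t l →
      (∀ l', l' < L → l' ≠ l → α j * p l - θ l > α j * p l' - θ l') ∧
      0 < α j * p l - θ l := by
  intro l hl j hj hlow hup
  have htmono : ∀ m, l ≤ m → m < L → j < t m := fun m hlm hm => by
    rcases hlm.eq_or_lt with rfl | h
    · exact hup
    · exact hup.trans (ht l m h hm)
  have hαanti : ∀ a b, a ≤ b → b < K → α b ≤ α a := fun a b hab hb => by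
    rcases hab.eq_or_lt with rfl | h
    · exact le_rfl
    · exact (hα a b h hb).le
  have htop : ∀ m, m < L → t m ≤ K := fun m hm => by
    rcases (Nat.le_sub_one_of_lt hm).eq_or_lt with rfl | h
    · exact htK
    · exact (htK' m (by omega)).le
  have hdown : ∀ m, l ≤ m → m + 1 < L →
      α j * p (m + 1) - θ (m + 1) < α j * p m - θ m := fun m hlm hm => by
    have hjm := htmono m hlm (by omega)
    have hKm := htop m (by omega)
    have hαj := hαanti j (t m - 1) (by omega) (by omega)
    have hpm := hp m (m + 1) (by omega) hm
    have := mul_le_mul_of_nonneg_right hαj (sub_pos.mpr hpm).le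
    linarith [(hθ m hm).2, mul_sub (α j) (p m) (p (m + 1))]
  have hclimb : ∀ m, m < l →
      α j * p m - θ m < α j * p (m + 1) - θ (m + 1) := fun m hml => by
    have hαj := hαanti (t m) j (hlow m hml) hj
    have hpm := hp m (m + 1) (by omega) (by omega)
    have := mul_le_mul_of_nonneg_right hαj (sub_pos.mpr hpm).le
    linarith [(hθ m (by omega)).1, mul_sub (α j) (p m) (p (m + 1))]
  have hright : ∀ m, l + 1 ≤ m → m < L → α j * p m - θ m < α j * p l - θ l := by
    intro m hlm
    induction m, hlm using Nat.le_induction with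
    | base => exact hdown l le_rfl
    | succ m hlm ih => exact fun hm => (hdown m (by omega) hm).trans (ih (by omega))
  have hleft : ∀ m, m < l → α j * p m - θ m < α j * p l - θ l := fun m hml => by
    refine Nat.le_induction (m := m + 1)
      (P := fun n _ => n ≤ l → α j * p m - θ m < α j * p n - θ n) (fun _ => hclimb m hml) ?_ l
      hml le_rfl
    exact fun n _ ih hnl => (ih (by omega)).trans (hclimb n (by omega))
  refine ⟨fun m hm hne => ?_, ?_⟩
  · rcases hne.lt_or_gt with h | h
    · exact hleft m h
    · exact hright m h hm
  · have hlast : 0 < α j * p (L - 1) - θ (L - 1) := by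
      have hjL := htmono (L - 1) (by omega) (by omega)
      have hαj := hαanti j (t (L - 1) - 1) (by omega) (by omega)
      have := mul_le_mul_of_nonneg_right hαj (hppos (L - 1) (by omega)).le
      linarith [hθL.2]
    rcases (Nat.le_sub_one_of_lt hl).eq_or_lt with rfl | h
    · exact hlast
    · exact hlast.trans (hright (L - 1) h (by omega))
end

section
/- Fix reals μ > 0 and ρ with 0 < ρ < 1, and for φ ≥ 0 define α_d(φ) = p₀(φ)·ρ·e^{(ρ−1)μφ}, where 1/p₀(φ) = 1 + ρ + (ρ²/(ρ−1))·(e^{(ρ−1)μφ} − 1). Then 1/p₀(φ) > 0 for all φ ≥ 0 (so α_d is well defined), and α_d is strictly decreasing on [0, ∞). -/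
/-- The deadline-miss proportion `α_d(φ) = p₀(φ)·ρ·e^{(ρ−1)μφ}` of the M/M/1 queue
with common maximum acceptable waiting time `φ`, where
`1/p₀(φ) = 1 + ρ + (ρ²/(ρ−1))·(e^{(ρ−1)μφ} − 1)`, is well defined
(`1/p₀(φ) > 0`) and strictly decreasing on `[0, ∞)`. -/
theorem deadline_miss_proportion_strictAnti (μ ρ : ℝ) (hμ : 0 < μ)
    (hρ0 : 0 < ρ) (hρ1 : ρ < 1) :
    (∀ φ : ℝ, 0 ≤ φ →
      0 < 1 + ρ + ρ ^ 2 / (ρ - 1) * (Real.exp ((ρ - 1) * μ * φ) - 1)) ∧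
    StrictAntiOn
      (fun φ : ℝ => ρ * Real.exp ((ρ - 1) * μ * φ) /
        (1 + ρ + ρ ^ 2 / (ρ - 1) * (Real.exp ((ρ - 1) * μ * φ) - 1)))
      (Set.Ici (0 : ℝ)) := by
  have hc : ρ ^ 2 / (ρ - 1) < 0 := div_neg_of_pos_of_neg (by positivity) (by linarith)
  have hrate : (ρ - 1) * μ < 0 := mul_neg_of_neg_of_pos (by linarith) hμ
  have hpos : ∀ φ : ℝ, 0 ≤ φ →
      0 < 1 + ρ + ρ ^ 2 / (ρ - 1) * (Real.exp ((ρ - 1) * μ * φ) - 1) := by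
    intro φ hφ
    have hexp : Real.exp ((ρ - 1) * μ * φ) ≤ 1 :=
      Real.exp_le_one_iff.mpr (mul_nonpos_of_nonpos_of_nonneg hrate.le hφ)
    have hterm := mul_nonneg_of_nonpos_of_nonpos hc.le (sub_nonpos.mpr hexp)
    linarith
  refine ⟨hpos, fun a ha b hb hab => ?_⟩
  have hexp : Real.exp ((ρ - 1) * μ * b) < Real.exp ((ρ - 1) * μ * a) :=
    Real.exp_lt_exp.mpr (mul_lt_mul_of_neg_left hab hrate)
  refine (div_lt_div_iff₀ (hpos b hb) (hpos a ha)).mpr ?_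
  have hcoef : 0 < ρ * (1 + ρ - ρ ^ 2 / (ρ - 1)) := mul_pos hρ0 (by linarith)
  linear_combination mul_lt_mul_of_pos_left hexp hcoef
end
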